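/- Let M ∈ ℂ^{q×m}, R_n = σ_n² I_q with σ_n² > 0, and let E(F) = (I_m + M^H F^H G^H (G F R_n F^H G^H + σ_v² I)^{-1} G F M)^{-1} be the LMMSE error covariance for any precoder F and channel G. Then Tr(E(F)) ≥ Tr((I_m + (1/σ_n²) M^H M)^{-1}), i.e., the decentralized MSE is lower bounded by the centralized MMSE benchmark. -/

import Mathlib

open Matrix

open scoped ComplexOrder

/-- Inversion is antitone on positive definite matrices. -/
theorem posSemidef_inv_sub_inv {m : ℕ} (A B : Matrix (Fin m) (Fin m) ℂ)
    (hA : A.PosDef) (hB : B.PosDef) (hD : (B - A).PosSemidef) : (A⁻¹ - B⁻¹).PosSemidef := by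
  have a1 : A⁻¹ * A = 1 := nonsing_inv_mul _ ((isUnit_iff_isUnit_det A).1 hA.isUnit)
  have a2 : A * A⁻¹ = 1 := mul_nonsing_inv _ ((isUnit_iff_isUnit_det A).1 hA.isUnit)
  have b1 : B⁻¹ * B = 1 := nonsing_inv_mul _ ((isUnit_iff_isUnit_det B).1 hB.isUnit)
  have b2 : B * B⁻¹ = 1 := mul_nonsing_inv _ ((isUnit_iff_isUnit_det B).1 hB.isUnit)
  have hBi : (B⁻¹)ᴴ = B⁻¹ := hB.inv.isHermitian
  have hDh : (B - A)ᴴ = B - A := hD.isHermitian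
  have e1 : A⁻¹ * (B - A) * B⁻¹ = A⁻¹ - B⁻¹ := by
    rw [mul_sub, sub_mul, a1, mul_assoc, b2, mul_one, one_mul]
  have e2 : B⁻¹ * (B - A) * A⁻¹ = A⁻¹ - B⁻¹ := by
    rw [mul_sub, sub_mul, b1, mul_assoc, a2, mul_one, one_mul]
  have key : A⁻¹ - B⁻¹ = (B⁻¹)ᴴ * (B - A) * B⁻¹
      + ((B - A) * B⁻¹)ᴴ * A⁻¹ * ((B - A) * B⁻¹) := by
    rw [conjTranspose_mul, hBi, hDh, e2, ← mul_assoc, ← add_mul, ← add_mul]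
    rw [add_sub_cancel, e1]
  rw [key]
  exact (hD.conjTranspose_mul_mul_same _).add (hA.inv.posSemidef.conjTranspose_mul_mul_same _)

/-- The filtered information matrix is dominated by the direct one. -/
theorem posSemidef_info {p q : ℕ} (s v : ℝ) (hs : 0 < s) (hv : 0 < v)
    (H : Matrix (Fin p) (Fin q) ℂ) (W : Matrix (Fin p) (Fin p) ℂ)
    (hW : W = (s : ℂ) • (H * Hᴴ) + (v : ℂ) • 1) :
    W.PosDef ∧ ((s : ℂ)⁻¹ • 1 - Hᴴ * W⁻¹ * H).PosSemidef := by
  have hs' : (0 : ℂ) < s := by exact_mod_cast hs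
  have hv' : (0 : ℂ) < v := by exact_mod_cast hv
  have hWp : W.PosDef := by
    rw [hW]
    exact PosDef.posSemidef_add ((posSemidef_self_mul_conjTranspose H).smul hs'.le)
      (PosDef.one.smul hv')
  refine ⟨hWp, ?_⟩
  have w1 : W * W⁻¹ = 1 := mul_nonsing_inv _ ((isUnit_iff_isUnit_det W).1 hWp.isUnit)
  have hWi : (W⁻¹)ᴴ = W⁻¹ := hWp.inv.isHermitian
  set P := W⁻¹ * H with hP
  have hPH : Pᴴ = Hᴴ * W⁻¹ := by rw [hP, conjTranspose_mul, hWi]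
  have hWP : W * P = H := by rw [hP, ← Matrix.mul_assoc, w1, Matrix.one_mul]
  have h3 : (s : ℂ) • (H * (Hᴴ * P)) + (v : ℂ) • P = H := by
    rw [← Matrix.mul_assoc]
    conv_rhs => rw [← hWP, hW]
    simp [Matrix.add_mul]
  have h4 : (s : ℂ) • (Pᴴ * (H * (Hᴴ * P))) + (v : ℂ) • (Pᴴ * P) = Pᴴ * H := by
    conv_rhs => rw [← h3]
    simp [Matrix.mul_add]
  have h5 : Pᴴ * H = Hᴴ * P := by rw [hPH, hP, Matrix.mul_assoc]
  have key : (s : ℂ)⁻¹ • 1 - Hᴴ * W⁻¹ * H =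
      (s : ℂ)⁻¹ • ((1 - (s : ℂ) • (Hᴴ * P))ᴴ * (1 - (s : ℂ) • (Hᴴ * P)))
        + (v : ℂ) • (Pᴴ * P) := by
    have h6 : (v : ℂ) • (Pᴴ * P) = Pᴴ * H - (s : ℂ) • (Pᴴ * (H * (Hᴴ * P))) := by
      rw [← h4]; abel
    have hc : (1 - (s : ℂ) • (Hᴴ * P))ᴴ = 1 - (s : ℂ) • (Pᴴ * H) := by
      simp [conjTranspose_sub, conjTranspose_smul, conjTranspose_mul]
    have h7 : Pᴴ * (H * (Hᴴ * P)) = (Hᴴ * P) * (Hᴴ * P) := by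
      rw [← Matrix.mul_assoc, h5]
    rw [h6, hc, h7, h5, Matrix.mul_assoc, ← hP]
    generalize Hᴴ * P = X
    simp only [Matrix.mul_sub, Matrix.sub_mul, Matrix.one_mul, Matrix.mul_one, smul_sub,
      Matrix.smul_mul, Matrix.mul_smul, smul_smul, inv_mul_cancel₀ hs'.ne', one_smul]
    rw [← mul_assoc, inv_mul_cancel₀ hs'.ne', one_mul]
    abel
  rw [key]
  exact ((posSemidef_conjTranspose_mul_self _).smul (inv_pos.2 hs').le).add
    ((posSemidef_conjTranspose_mul_self _).smul hv'.le)

/-- The decentralized LMMSE MSE is lower bounded by the centralized MMSE: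
`Tr(E(F)) ≥ Tr((I + (1/σ_n²) Mᴴ M)⁻¹)` for every precoder `F` and channel `G`,
where `E(F) = (I + Mᴴ Fᴴ Gᴴ (G F R_n Fᴴ Gᴴ + σ_v² I)⁻¹ G F M)⁻¹` and
`R_n = σ_n² I`. -/
theorem centralized_mmse_bound {nR nT q m : ℕ}
    (σn2 σv2 : ℝ) (hn : 0 < σn2) (hv : 0 < σv2)
    (M : Matrix (Fin q) (Fin m) ℂ)
    (G : Matrix (Fin nR) (Fin nT) ℂ) (F : Matrix (Fin nT) (Fin q) ℂ)
    (Rn : Matrix (Fin q) (Fin q) ℂ) (hRn : Rn = (σn2 : ℂ) • 1)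
    (E : Matrix (Fin m) (Fin m) ℂ)
    (hE : E = (1 + Mᴴ * Fᴴ * Gᴴ *
      (G * F * Rn * Fᴴ * Gᴴ + (σv2 : ℂ) • 1)⁻¹ * G * F * M)⁻¹) :
    ((1 + (σn2 : ℂ)⁻¹ • (Mᴴ * M))⁻¹).trace.re ≤ E.trace.re := by
  subst hRn
  obtain ⟨hW, hI⟩ := posSemidef_info σn2 σv2 hn hv (G * F) _ rfl
  have hs' : (0 : ℂ) < σn2 := by exact_mod_cast hn
  have eW : G * F * ((σn2 : ℂ) • (1 : Matrix (Fin q) (Fin q) ℂ)) * Fᴴ * Gᴴ + (σv2 : ℂ) • 1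
      = (σn2 : ℂ) • ((G * F) * (G * F)ᴴ) + (σv2 : ℂ) • 1 := by
    simp [Matrix.mul_assoc, conjTranspose_mul]
  rw [eW] at hE
  set W := (σn2 : ℂ) • ((G * F) * (G * F)ᴴ) + (σv2 : ℂ) • (1 : Matrix (Fin nR) (Fin nR) ℂ)
  have eM : Mᴴ * Fᴴ * Gᴴ * W⁻¹ * G * F * M = (G * F * M)ᴴ * W⁻¹ * (G * F * M) := by
    simp [Matrix.mul_assoc, conjTranspose_mul]
  have hA : (1 + (G * F * M)ᴴ * W⁻¹ * (G * F * M)).PosDef :=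
    PosDef.one.add_posSemidef (hW.inv.posSemidef.conjTranspose_mul_mul_same _)
  have hB : (1 + (σn2 : ℂ)⁻¹ • (Mᴴ * M)).PosDef :=
    PosDef.one.add_posSemidef ((posSemidef_conjTranspose_mul_self _).smul (inv_pos.2 hs').le)
  have hD : ((1 + (σn2 : ℂ)⁻¹ • (Mᴴ * M)) -
      (1 + (G * F * M)ᴴ * W⁻¹ * (G * F * M))).PosSemidef := by
    have h := hI.conjTranspose_mul_mul_same M
    convert h using 1
    simp [Matrix.mul_sub, Matrix.sub_mul, Matrix.mul_assoc, conjTranspose_mul]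
  have h := (posSemidef_inv_sub_inv _ _ hA hB hD).trace_nonneg
  rw [trace_sub] at h
  have h2 := (Complex.le_def.1 h).1
  rw [hE, eM]
  simp only [Complex.zero_re, Complex.sub_re] at h2
  linarith
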